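/- In the two-patch data model, for every weight matrix W, every filter index j ∈ {1, …, J}, and every data index i ∈ {1, …, N}, the Frobenius norm of the full gradient matrix satisfies ‖∇L(W)‖_F ≥ (3/N) · l_i · ⟨w_j, ξ_i⟩² · ‖ξ_i‖, where ‖∇L(W)‖_F = (Σ_{j=1}^J ‖∇_{w_j} L(W)‖²)^{1/2}. -/

import Mathlib

open scoped BigOperators RealInnerProductSpace

/-- The sigmoid (logistic) function. -/
noncomputable def sigmoid (z : ℝ) : ℝ := 1 / (1 + Real.exp (-z))

lemma hasDerivAt_log_one_add_exp_neg (s : ℝ) :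
    HasDerivAt (fun s => Real.log (1 + Real.exp (-s))) (-sigmoid (-s)) s := by
  have hpos : 1 + Real.exp (-s) ≠ 0 := by positivity
  have h := (((hasDerivAt_id s).neg.exp).const_add 1).log hpos
  refine h.congr_deriv ?_
  have hpos' : 1 + Real.exp s ≠ 0 := by positivity
  have hmul : Real.exp (-s) * Real.exp s = 1 := by rw [← Real.exp_add]; simp
  simp only [sigmoid, neg_neg, Pi.neg_apply, id_eq]
  field_simp
  linear_combination -hmul

section

variable {E : Type*} [NormedAddCommGroup E] [InnerProductSpace ℝ E]

lemma hasFDerivAt_inner_cube (a w : E) :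
    HasFDerivAt (fun w : E => ⟪w, a⟫ ^ 3) ((3 * ⟪w, a⟫ ^ 2) • innerSL ℝ a) w := by
  have h : HasFDerivAt (fun w : E => ⟪w, a⟫) (innerSL ℝ a) w := by
    simpa [real_inner_comm] using (innerSL ℝ a).hasFDerivAt (x := w)
  simpa using h.pow 3

/-- The derivative, in one filter, of the logistic loss of a cubic network with two patches `a`
and `b`, where `c` is the output of the other filters. -/
lemma hasFDerivAt_logistic_inner_cube (y c : ℝ) (a b w : E) :
    HasFDerivAt
      (fun w : E => Real.log (1 + Real.exp (-(y * (c + (⟪w, a⟫ ^ 3 + ⟪w, b⟫ ^ 3))))))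
      ((-sigmoid (-(y * (c + (⟪w, a⟫ ^ 3 + ⟪w, b⟫ ^ 3))))) •
        y • ((3 * ⟪w, a⟫ ^ 2) • innerSL ℝ a + (3 * ⟪w, b⟫ ^ 2) • innerSL ℝ b)) w :=
  (hasDerivAt_log_one_add_exp_neg _).comp_hasFDerivAt w
    ((((hasFDerivAt_inner_cube a w).add (hasFDerivAt_inner_cube b w)).const_add c).const_mul y)

lemma abs_fderiv_le_norm_gradient_mul [CompleteSpace E] {g : E → ℝ} {g' : E →L[ℝ] ℝ} {w : E}
    (h : HasFDerivAt g g' w) (v : E) : |g' v| ≤ ‖gradient g w‖ * ‖v‖ := by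
  have hv : g' v = ⟪gradient g w, v⟫ := by
    rw [gradient, InnerProductSpace.toDual_symm_apply, h.fderiv]
  rw [hv]
  exact abs_real_inner_le_norm _ _

end

/-- Frobenius-norm lower bound on the full gradient matrix:
for every filter `j` and data index `i`,
`‖∇L(W)‖_F ≥ (3/N)·l_i·⟨w_j, ξ_i⟩²·‖ξ_i‖`. -/
theorem gradient_frobenius_norm_lower_bound
    (d N J m : ℕ) (hd : 1 ≤ d) (hN : 1 ≤ N) (hJ : 1 ≤ J)
    (α : ℝ) (hα0 : 0 < α) (hα1 : α < 1) (hm : (m : ℝ) = α * N)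
    (βd βe : ℝ) (hβd : 0 ≤ βd) (hβ : βd < βe)
    (ve vd : EuclideanSpace ℝ (Fin d)) (hve : ‖ve‖ = 1) (hvd : ‖vd‖ = 1)
    (hvevd : ⟪ve, vd⟫ = 0)
    (y : ℕ → ℝ) (hy : ∀ i < N, y i = 1 ∨ y i = -1)
    (ξ : ℕ → EuclideanSpace ℝ (Fin d)) (hξ : ∀ i < N, ξ i ≠ 0)
    (hξorth : ∀ i < N, ∀ i' < N, i ≠ i' → ⟪ξ i, ξ i'⟫ = 0)
    (hξe : ∀ i < N, ⟪ξ i, ve⟫ = 0) (hξd : ∀ i < N, ⟪ξ i, vd⟫ = 0)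
    -- the feature patch of the `i`-th data point
    (feat : ℕ → EuclideanSpace ℝ (Fin d))
    (hfeat : ∀ i < N, feat i = if i < m then (βe * y i) • ve else (βd * y i) • vd)
    -- the two-layer cubic CNN applied to the `i`-th data point (patches `feat i` and `ξ i`)
    (f : (Fin J → EuclideanSpace ℝ (Fin d)) → ℕ → ℝ)
    (hf : ∀ W i, f W i = ∑ j : Fin J, (⟪W j, feat i⟫ ^ 3 + ⟪W j, ξ i⟫ ^ 3))
    -- the empirical logistic loss on the original dataset
    (L : (Fin J → EuclideanSpace ℝ (Fin d)) → ℝ)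
    (hL : ∀ W, L W = (1 / (N : ℝ)) *
      ∑ i ∈ Finset.range N, Real.log (1 + Real.exp (-(y i * f W i))))
    (W : Fin J → EuclideanSpace ℝ (Fin d)) (j : Fin J)
    -- the logits
    (l : ℕ → ℝ) (hl : ∀ i, l i = sigmoid (-(y i * f W i)))
    -- the columns of the full gradient matrix
    (G : Fin J → EuclideanSpace ℝ (Fin d))
    (hG : ∀ j' : Fin J, G j' = gradient (fun w => L (Function.update W j' w)) (W j'))
    :
    ∀ i < N,
      (3 / (N : ℝ)) * l i * ⟪W j, ξ i⟫ ^ 2 * ‖ξ i‖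
        ≤ Real.sqrt (∑ j' : Fin J, ‖G j'‖ ^ 2) := by
  intro i hi
  have hsplit : ∀ w k, f (Function.update W j w) k =
      ∑ j' ∈ Finset.univ.erase j, (⟪W j', feat k⟫ ^ 3 + ⟪W j', ξ k⟫ ^ 3) +
        (⟪w, feat k⟫ ^ 3 + ⟪w, ξ k⟫ ^ 3) := by
    intro w k
    rw [hf, ← Finset.sum_erase_add _ _ (Finset.mem_univ j), Function.update_self]
    congr 1
    refine Finset.sum_congr rfl fun j' hj' => ?_
    rw [Function.update_of_ne (Finset.ne_of_mem_erase hj')]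
  have hlogit : ∀ k, l k = sigmoid (-(y k *
      (∑ j' ∈ Finset.univ.erase j, (⟪W j', feat k⟫ ^ 3 + ⟪W j', ξ k⟫ ^ 3) +
        (⟪W j, feat k⟫ ^ 3 + ⟪W j, ξ k⟫ ^ 3)))) := by
    intro k
    rw [hl, ← hsplit, Function.update_eq_self]
  have hderiv : HasFDerivAt (fun w => L (Function.update W j w))
      ((1 / (N : ℝ)) • ∑ k ∈ Finset.range N, (-l k) • y k •
        ((3 * ⟪W j, feat k⟫ ^ 2) • innerSL ℝ (feat k) +
          (3 * ⟪W j, ξ k⟫ ^ 2) • innerSL ℝ (ξ k))) (W j) := by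
    simp only [hL, hsplit, hlogit]
    exact (HasFDerivAt.fun_sum fun k _ =>
      hasFDerivAt_logistic_inner_cube (y k) _ (feat k) (ξ k) (W j)).const_mul _
  have hfeat_orth : ∀ k < N, ⟪feat k, ξ i⟫ = 0 := by
    intro k hk
    rw [hfeat k hk, real_inner_comm]
    split_ifs <;> simp [inner_smul_right, hξe i hi, hξd i hi]
  have hbound := abs_fderiv_le_norm_gradient_mul hderiv (ξ i)
  rw [← hG j] at hbound
  simp only [smul_apply, sum_apply,
    add_apply, innerSL_apply_apply, smul_eq_mul] at hbound
  rw [Finset.sum_eq_single_of_mem i (Finset.mem_range.2 hi) (fun k hk hki => by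
      rw [hfeat_orth k (Finset.mem_range.1 hk), hξorth k (Finset.mem_range.1 hk) i hi hki]
      ring), hfeat_orth i hi, real_inner_self_eq_norm_sq] at hbound
  have hy_abs : |y i| = 1 := by rcases hy i hi with h | h <;> simp [h]
  have hl_nonneg : 0 ≤ l i := by rw [hl, sigmoid]; positivity
  have hξ_pos : 0 < ‖ξ i‖ := norm_pos_iff.2 (hξ i hi)
  have hcol : (3 / (N : ℝ)) * l i * ⟪W j, ξ i⟫ ^ 2 * ‖ξ i‖ ≤ ‖G j‖ := by
    refine le_of_mul_le_mul_right (le_of_eq_of_le ?_ hbound) hξ_pos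
    simp only [mul_zero, zero_add, abs_mul, abs_neg, hy_abs, abs_of_nonneg hl_nonneg, abs_pow,
      abs_norm, sq_abs, abs_div, abs_one, Nat.abs_cast, Nat.abs_ofNat]
    ring
  refine hcol.trans (Real.le_sqrt_of_sq_le ?_)
  exact Finset.single_le_sum (f := fun j' => ‖G j'‖ ^ 2) (fun _ _ => sq_nonneg _)
    (Finset.mem_univ j)
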